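/- Let P be a real symmetric m×m matrix and q ≤ m. A matrix Q ∈ ℝ^{m×q} with orthonormal columns maximizes tr(Qᵀ P Q) over all matrices with orthonormal columns if and only if the column space of Q equals V₁ ⊕ ⋯ ⊕ V_{k−1} ⊕ W_k, where V_i is the eigenspace of the i-th largest distinct eigenvalue λ_i of P (of multiplicity m_i), k is the smallest integer with m₁+⋯+m_k ≥ q, and W_k is some subspace of V_k of dimension q − (m₁+⋯+m_{k−1}). -/

import Mathlib

open Matrix Module

namespace Aux8

/-- vectors whose `U`-coordinates vanish outside `T` -/
def S {m : ℕ} (U : Matrix (Fin m) (Fin m) ℝ) (T : Finset (Fin m)) : Submodule ℝ (Fin m → ℝ) where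
  carrier := {x | ∀ j, j ∉ T → (Uᵀ *ᵥ x) j = 0}
  add_mem' := by
    intro a b ha hb j hj
    rw [Matrix.mulVec_add, Pi.add_apply, ha j hj, hb j hj, add_zero]
  zero_mem' := by
    intro j hj
    simp
  smul_mem' := by
    intro c x hx j hj
    rw [Matrix.mulVec_smul, Pi.smul_apply, hx j hj, smul_zero]

lemma mem_S {m : ℕ} {U : Matrix (Fin m) (Fin m) ℝ} {T : Finset (Fin m)} {x : Fin m → ℝ} :
    x ∈ S U T ↔ ∀ j, j ∉ T → (Uᵀ *ᵥ x) j = 0 := Iff.rfl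

lemma expand {m : ℕ} {U : Matrix (Fin m) (Fin m) ℝ} (hU' : U * Uᵀ = 1) (x : Fin m → ℝ) :
    x = ∑ j, (Uᵀ *ᵥ x) j • U.col j := by
  have h : x = U *ᵥ (Uᵀ *ᵥ x) := by
    rw [Matrix.mulVec_mulVec, hU', Matrix.one_mulVec]
  conv_lhs => rw [h]
  rw [Matrix.mulVec_eq_sum]
  simp [Matrix.col, Matrix.transpose]

lemma coord_col {m : ℕ} {U : Matrix (Fin m) (Fin m) ℝ} (hU : Uᵀ * U = 1) (j : Fin m) :
    Uᵀ *ᵥ U.col j = Pi.single j 1 := by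
  rw [← Matrix.mulVec_single_one, Matrix.mulVec_mulVec, hU, Matrix.one_mulVec]

lemma col_mem_S {m : ℕ} {U : Matrix (Fin m) (Fin m) ℝ} (hU : Uᵀ * U = 1) {T : Finset (Fin m)}
    {j : Fin m} (hj : j ∈ T) : U.col j ∈ S U T := by
  intro l hl
  rw [coord_col hU, Pi.single_apply, if_neg]
  rintro rfl
  exact hl hj

lemma S_le {m : ℕ} {U : Matrix (Fin m) (Fin m) ℝ} (hU' : U * Uᵀ = 1) {T : Finset (Fin m)}
    {X : Submodule ℝ (Fin m → ℝ)} (h : ∀ j ∈ T, U.col j ∈ X) : S U T ≤ X := by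
  intro x hx
  rw [expand hU' x]
  refine Submodule.sum_mem _ fun j _ => ?_
  by_cases hj : j ∈ T
  · exact X.smul_mem _ (h j hj)
  · rw [hx j hj, zero_smul]
    exact X.zero_mem

lemma finrank_S {m : ℕ} {U : Matrix (Fin m) (Fin m) ℝ} (hU : Uᵀ * U = 1) (hU' : U * Uᵀ = 1)
    (T : Finset (Fin m)) : finrank ℝ (S U T) = T.card := by
  have h1 : S U T = Submodule.span ℝ (Set.range (fun j : T => U.col j.1)) := by
    apply le_antisymm
    · exact S_le hU' fun j hj => Submodule.subset_span ⟨⟨j, hj⟩, rfl⟩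
    · rw [Submodule.span_le]
      rintro _ ⟨j, rfl⟩
      exact col_mem_S hU j.2
  have hli : LinearIndependent ℝ (fun j : Fin m => U.col j) := by
    apply Matrix.linearIndependent_cols_of_isUnit
    exact (isUnit_iff_exists).2 ⟨Uᵀ, hU', hU⟩
  rw [h1]
  refine (finrank_span_eq_card (hli.comp (fun j : T => j.1) Subtype.val_injective)).trans ?_
  simp

lemma mem_range_iff {m q : ℕ} {Q : Matrix (Fin m) (Fin q) ℝ} (hQ : Qᵀ * Q = 1) (x : Fin m → ℝ) :
    x ∈ LinearMap.range Q.mulVecLin ↔ (Q * Qᵀ) *ᵥ x = x := by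
  constructor
  · rintro ⟨y, rfl⟩
    rw [Matrix.mulVecLin_apply, Matrix.mulVec_mulVec, Matrix.mul_assoc, hQ, Matrix.mul_one]
  · intro h
    exact ⟨Qᵀ *ᵥ x, by rw [Matrix.mulVecLin_apply, Matrix.mulVec_mulVec, h]⟩

lemma finrank_range {m q : ℕ} {Q : Matrix (Fin m) (Fin q) ℝ} (hQ : Qᵀ * Q = 1) :
    finrank ℝ (LinearMap.range Q.mulVecLin) = q := by
  rw [LinearMap.finrank_range_of_inj]
  · simp
  · intro x y h
    have := congrArg (fun v => Qᵀ *ᵥ v) h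
    simpa [Matrix.mulVec_mulVec, hQ] using this

/-- weights -/
def w {m q : ℕ} (U : Matrix (Fin m) (Fin m) ℝ) (Q : Matrix (Fin m) (Fin q) ℝ) (j : Fin m) : ℝ :=
  ∑ c, ((Uᵀ * Q) j c) ^ 2

lemma w_eq {m q : ℕ} (U : Matrix (Fin m) (Fin m) ℝ) (Q : Matrix (Fin m) (Fin q) ℝ) (j : Fin m) :
    w U Q j = ((Uᵀ * Q) * (Uᵀ * Q)ᵀ) j j := by
  rw [w, Matrix.mul_apply]
  exact Finset.sum_congr rfl fun c _ => by rw [Matrix.transpose_apply, sq]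

lemma trace_eq {m q : ℕ} {P U : Matrix (Fin m) (Fin m) ℝ} {d : Fin m → ℝ}
    (hPd : P = U * diagonal d * Uᵀ) (Q : Matrix (Fin m) (Fin q) ℝ) :
    trace (Qᵀ * P * Q) = ∑ j, d j * w U Q j := by
  have : Qᵀ * P * Q = (Uᵀ * Q)ᵀ * (diagonal d * (Uᵀ * Q)) := by
    rw [hPd, Matrix.transpose_mul, Matrix.transpose_transpose]
    simp only [Matrix.mul_assoc]
  rw [this, Matrix.trace_mul_comm, Matrix.trace]
  refine Finset.sum_congr rfl fun j _ => ?_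
  rw [w_eq, Matrix.diag_apply, Matrix.mul_assoc, Matrix.diagonal_mul]

lemma ZZ {m q : ℕ} {U : Matrix (Fin m) (Fin m) ℝ} (hU' : U * Uᵀ = 1)
    {Q : Matrix (Fin m) (Fin q) ℝ} (hQ : Qᵀ * Q = 1) : (Uᵀ * Q)ᵀ * (Uᵀ * Q) = 1 := by
  rw [Matrix.transpose_mul, Matrix.transpose_transpose, Matrix.mul_assoc, ← Matrix.mul_assoc U,
    hU', Matrix.one_mul, hQ]

lemma sum_w {m q : ℕ} {U : Matrix (Fin m) (Fin m) ℝ} (hU' : U * Uᵀ = 1)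
    {Q : Matrix (Fin m) (Fin q) ℝ} (hQ : Qᵀ * Q = 1) : ∑ j, w U Q j = q := by
  have : ∑ j, w U Q j = trace ((Uᵀ * Q) * (Uᵀ * Q)ᵀ) :=
    Finset.sum_congr rfl fun j _ => w_eq U Q j
  rw [this, Matrix.trace_mul_comm, ZZ hU' hQ]
  simp

lemma one_sub_w {m q : ℕ} {U : Matrix (Fin m) (Fin m) ℝ} (hU : Uᵀ * U = 1) (hU' : U * Uᵀ = 1)
    {Q : Matrix (Fin m) (Fin q) ℝ} (hQ : Qᵀ * Q = 1) (j : Fin m) :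
    1 - w U Q j = ∑ l, ((1 - (Uᵀ * Q) * (Uᵀ * Q)ᵀ : Matrix (Fin m) (Fin m) ℝ) l j) ^ 2 := by
  have hz := ZZ hU' hQ
  rw [w_eq]
  generalize Uᵀ * Q = Z at *
  have hN : (1 - Z * Zᵀ)ᵀ * (1 - Z * Zᵀ) = 1 - Z * Zᵀ := by
    have h2 : Z * Zᵀ * (Z * Zᵀ) = Z * Zᵀ := by
      rw [Matrix.mul_assoc, ← Matrix.mul_assoc Zᵀ, hz, Matrix.one_mul]
    rw [Matrix.transpose_sub, Matrix.transpose_one, Matrix.transpose_mul,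
      Matrix.transpose_transpose, Matrix.mul_sub, Matrix.sub_mul, Matrix.sub_mul, h2]
    simp
  have h3 := congrFun (congrFun hN j) j
  rw [Matrix.mul_apply] at h3
  have h4 : (1 - Z * Zᵀ : Matrix (Fin m) (Fin m) ℝ) j j = 1 - (Z * Zᵀ) j j := by simp
  rw [← h4, ← h3]
  exact Finset.sum_congr rfl fun c _ => by rw [Matrix.transpose_apply, sq]

lemma w_nonneg {m q : ℕ} (U : Matrix (Fin m) (Fin m) ℝ) (Q : Matrix (Fin m) (Fin q) ℝ)
    (j : Fin m) : 0 ≤ w U Q j := Finset.sum_nonneg fun _ _ => sq_nonneg _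

lemma w_le_one {m q : ℕ} {U : Matrix (Fin m) (Fin m) ℝ} (hU : Uᵀ * U = 1) (hU' : U * Uᵀ = 1)
    {Q : Matrix (Fin m) (Fin q) ℝ} (hQ : Qᵀ * Q = 1) (j : Fin m) : w U Q j ≤ 1 := by
  have := one_sub_w hU hU' hQ j
  have h2 : 0 ≤ ∑ l, ((1 - (Uᵀ * Q) * (Uᵀ * Q)ᵀ : Matrix (Fin m) (Fin m) ℝ) l j) ^ 2 :=
    Finset.sum_nonneg fun _ _ => sq_nonneg _
  linarith

lemma w_eq_zero {m q : ℕ} {U : Matrix (Fin m) (Fin m) ℝ} {Q : Matrix (Fin m) (Fin q) ℝ}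
    (j : Fin m) : w U Q j = 0 ↔ ∀ x ∈ LinearMap.range Q.mulVecLin, (Uᵀ *ᵥ x) j = 0 := by
  rw [w, Finset.sum_eq_zero_iff_of_nonneg (fun _ _ => sq_nonneg _)]
  constructor
  · rintro h _ ⟨y, rfl⟩
    rw [Matrix.mulVecLin_apply, Matrix.mulVec_mulVec, Matrix.mulVec, dotProduct]
    refine Finset.sum_eq_zero fun c hc => ?_
    rw [pow_eq_zero_iff two_ne_zero |>.1 (h c hc), zero_mul]
  · intro h c _
    have := h (Q *ᵥ Pi.single c 1) ⟨_, rfl⟩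
    rw [Matrix.mulVec_mulVec, Matrix.mulVec_single_one] at this
    rw [show (Uᵀ * Q) j c = 0 from this]
    simp

lemma w_eq_one {m q : ℕ} {U : Matrix (Fin m) (Fin m) ℝ} (hU : Uᵀ * U = 1) (hU' : U * Uᵀ = 1)
    {Q : Matrix (Fin m) (Fin q) ℝ} (hQ : Qᵀ * Q = 1) (j : Fin m) :
    w U Q j = 1 ↔ U.col j ∈ LinearMap.range Q.mulVecLin := by
  have h0 : w U Q j = 1 ↔ (1 - (Uᵀ * Q) * (Uᵀ * Q)ᵀ) *ᵥ Pi.single j 1 = 0 := by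
    rw [eq_comm, ← sub_eq_zero, one_sub_w hU hU' hQ,
      Finset.sum_eq_zero_iff_of_nonneg (fun _ _ => sq_nonneg _), Matrix.mulVec_single_one]
    constructor
    · intro h
      funext l
      exact pow_eq_zero_iff two_ne_zero |>.1 (h l (Finset.mem_univ _))
    · intro h l _
      have := congrFun h l
      rw [show (1 - (Uᵀ * Q) * (Uᵀ * Q)ᵀ : Matrix (Fin m) (Fin m) ℝ) l j = 0 from this]
      simp
  have h1 : (1 - (Uᵀ * Q) * (Uᵀ * Q)ᵀ) *ᵥ Pi.single j 1
      = Uᵀ *ᵥ (U.col j - (Q * Qᵀ) *ᵥ U.col j) := by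
    rw [Matrix.mulVec_sub, coord_col hU, Matrix.sub_mulVec, Matrix.one_mulVec,
      ← Matrix.mulVec_single_one]
    simp only [Matrix.mulVec_mulVec, Matrix.transpose_mul, Matrix.transpose_transpose,
      Matrix.mul_assoc]
  rw [h0, h1, mem_range_iff hQ]
  constructor
  · intro h
    have := congrArg (fun v => U *ᵥ v) h
    simp only [Matrix.mulVec_mulVec, hU', Matrix.one_mulVec, Matrix.mulVec_zero] at this
    exact (sub_eq_zero.1 this).symm
  · intro h
    rw [h, sub_self, Matrix.mulVec_zero]

lemma bound {m q : ℕ} (d v : Fin m → ℝ) (μ : ℝ) (h0 : ∀ j, 0 ≤ v j) (h1 : ∀ j, v j ≤ 1)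
    (hs : ∑ j, v j = q) :
    ∑ j, d j * v j ≤ μ * q + ∑ j, max (d j - μ) 0 ∧
    (∑ j, d j * v j = μ * q + ∑ j, max (d j - μ) 0 ↔
      ∀ j, (μ < d j → v j = 1) ∧ (d j < μ → v j = 0)) := by
  have key : μ * q + ∑ j, max (d j - μ) 0 - ∑ j, d j * v j
      = ∑ j, (max (d j - μ) 0 - (d j - μ) * v j) := by
    rw [← hs, Finset.mul_sum, ← Finset.sum_add_distrib, ← Finset.sum_sub_distrib]
    exact Finset.sum_congr rfl fun j _ => by ring
  have nn : ∀ j ∈ Finset.univ, 0 ≤ max (d j - μ) 0 - (d j - μ) * v j := by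
    intro j _
    rcases le_total (d j - μ) 0 with h | h
    · rw [max_eq_right h]; nlinarith [h0 j]
    · rw [max_eq_left h]; nlinarith [h1 j]
  have hsum := Finset.sum_nonneg nn
  refine ⟨by linarith, ?_⟩
  rw [eq_comm, ← sub_eq_zero, key, Finset.sum_eq_zero_iff_of_nonneg nn]
  refine forall_congr' fun j => ?_
  simp only [Finset.mem_univ, true_imp_iff]
  rcases lt_trichotomy (d j) μ with h | h | h
  · rw [max_eq_right (by linarith)]
    have : d j - μ ≠ 0 := by linarith
    simp [h, h.not_gt, this]
  · simp [h]
  · rw [max_eq_left (by linarith)]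
    have : d j - μ ≠ 0 := by linarith
    simp only [h, h.not_gt, true_imp_iff, false_imp_iff, and_true]
    constructor
    · intro h'
      have : (d j - μ) * (1 - v j) = 0 := by linarith
      rcases mul_eq_zero.1 this with h | h
      · contradiction
      · linarith
    · intro h'
      rw [h']; ring

lemma exists_Q {m q : ℕ} {U : Matrix (Fin m) (Fin m) ℝ} (hU : Uᵀ * U = 1)
    (T : Finset (Fin m)) (hT : T.card = q) :
    ∃ Q : Matrix (Fin m) (Fin q) ℝ, Qᵀ * Q = 1 ∧ ∀ j, w U Q j = if j ∈ T then 1 else 0 := by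
  let e : Fin q ≃ T := (T.equivFinOfCardEq hT).symm
  have hz : Uᵀ * U.submatrix id (fun c => (e c).1) =
      (1 : Matrix (Fin m) (Fin m) ℝ).submatrix id (fun c => (e c).1) := by
    rw [← hU]; rfl
  refine ⟨U.submatrix id (fun c => (e c).1), ?_, fun j => ?_⟩
  · have : (U.submatrix id (fun c => (e c).1))ᵀ * U.submatrix id (fun c => (e c).1)
      = (Uᵀ * U).submatrix (fun c => (e c).1) (fun c => (e c).1) := rfl
    rw [this, hU]
    exact Matrix.submatrix_one _ (Subtype.val_injective.comp e.injective)
  · rw [w, hz]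
    simp only [Matrix.submatrix_apply, id, Matrix.one_apply, ite_pow, one_pow, zero_pow two_ne_zero]
    rw [e.sum_comp (fun t => if j = t.1 then (1 : ℝ) else 0),
      Finset.sum_coe_sort T (fun t => if j = t then (1 : ℝ) else 0)]
    simp

lemma exists_diag {m : ℕ} (P : Matrix (Fin m) (Fin m) ℝ) (hP : Pᵀ = P) :
    ∃ (U : Matrix (Fin m) (Fin m) ℝ) (d : Fin m → ℝ), Uᵀ * U = 1 ∧ U * Uᵀ = 1 ∧
      P = U * diagonal d * Uᵀ := by
  have hH : P.IsHermitian := by rw [Matrix.IsHermitian, conjTranspose_eq_transpose_of_trivial, hP]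
  refine ⟨hH.eigenvectorUnitary, hH.eigenvalues, ?_, ?_, ?_⟩
  · rw [← conjTranspose_eq_transpose_of_trivial]
    exact Unitary.coe_star_mul_self hH.eigenvectorUnitary
  · rw [← conjTranspose_eq_transpose_of_trivial]
    exact Unitary.coe_mul_star_self hH.eigenvectorUnitary
  · rw [← conjTranspose_eq_transpose_of_trivial]
    have := hH.spectral_theorem
    rw [Unitary.conjStarAlgAut_apply] at this
    exact this

lemma eigenspace_eq {m : ℕ} {P U : Matrix (Fin m) (Fin m) ℝ} {d : Fin m → ℝ}
    (hU : Uᵀ * U = 1) (hU' : U * Uᵀ = 1) (hPd : P = U * diagonal d * Uᵀ) (l : ℝ) :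
    Module.End.eigenspace (Matrix.mulVecLin P) l = S U (Finset.univ.filter (fun j => d j = l)) := by
  ext x
  rw [Module.End.mem_eigenspace_iff, mem_S, Matrix.mulVecLin_apply]
  have h1 : P *ᵥ x = l • x ↔ ∀ j, d j * (Uᵀ *ᵥ x) j = l * (Uᵀ *ᵥ x) j := by
    have h2 : Uᵀ *ᵥ (P *ᵥ x) = diagonal d *ᵥ (Uᵀ *ᵥ x) := by
      rw [hPd, Matrix.mulVec_mulVec, Matrix.mulVec_mulVec, Matrix.mul_assoc, ← Matrix.mul_assoc, hU,
        Matrix.one_mul]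
    have h3 : P *ᵥ x = l • x ↔ Uᵀ *ᵥ (P *ᵥ x) = Uᵀ *ᵥ (l • x) := by
      constructor
      · intro h; rw [h]
      · intro h
        have := congrArg (fun v => U *ᵥ v) h
        simpa only [Matrix.mulVec_mulVec, ← Matrix.mul_assoc, hU', Matrix.one_mulVec,
          Matrix.one_mul] using this
    rw [h3, h2, Matrix.mulVec_smul, funext_iff]
    simp only [Matrix.mulVec_diagonal, Pi.smul_apply, smul_eq_mul]
  rw [h1]
  refine forall_congr' fun j => ?_
  simp only [Finset.mem_filter, Finset.mem_univ, true_and]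
  rw [mul_eq_mul_right_iff]
  tauto

end Aux8

open Aux8
theorem stmt_8 {m q L : ℕ} (hq0 : 0 < q) (hq : q ≤ m)
    (P : Matrix (Fin m) (Fin m) ℝ) (hP : Pᵀ = P)
    (lam : Fin L → ℝ) (hlam : StrictAnti lam)
    -- V i is the eigenspace of the i-th largest distinct eigenvalue
    (V : Fin L → Submodule ℝ (Fin m → ℝ))
    (hV : ∀ i, V i = Module.End.eigenspace (Matrix.mulVecLin P) (lam i))
    (hVne : ∀ i, V i ≠ ⊥)
    -- λ₁, …, λ_L are all the eigenvalues: multiplicities sum to m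
    (hcomplete : ∑ i : Fin L, finrank ℝ (V i) = m)
    (k : Fin L)
    (hk : q ≤ ∑ i ∈ Finset.univ.filter (· ≤ k), finrank ℝ (V i))
    (hkmin : ∀ j : Fin L, j < k →
      ∑ i ∈ Finset.univ.filter (· ≤ j), finrank ℝ (V i) < q)
    (Q : Matrix (Fin m) (Fin q) ℝ) (hQ : Qᵀ * Q = 1) :
    (∀ Q' : Matrix (Fin m) (Fin q) ℝ, Q'ᵀ * Q' = 1 →
        Matrix.trace (Q'ᵀ * P * Q') ≤ Matrix.trace (Qᵀ * P * Q))
      ↔ ∃ W : Submodule ℝ (Fin m → ℝ), W ≤ V k ∧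
          finrank ℝ W = q - ∑ i ∈ Finset.univ.filter (· < k), finrank ℝ (V i) ∧
          LinearMap.range Q.mulVecLin = (⨆ i : {i : Fin L // i < k}, V i.1) ⊔ W := by
  obtain ⟨U, d, hU, hU', hPd⟩ := exists_diag P hP
  have hVS : ∀ i, V i = S U (Finset.univ.filter (fun j => d j = lam i)) := fun i => by
    rw [hV, eigenspace_eq hU hU' hPd]
  have hfr : ∀ i, finrank ℝ (V i) = (Finset.univ.filter (fun j => d j = lam i)).card := fun i => by
    rw [hVS, finrank_S hU hU']
  have hcard : ∀ I : Finset (Fin L), ∑ i ∈ I, finrank ℝ (V i)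
      = (Finset.univ.filter (fun j => ∃ i ∈ I, d j = lam i)).card := by
    intro I
    have : Finset.univ.filter (fun j => ∃ i ∈ I, d j = lam i)
        = I.biUnion (fun i => Finset.univ.filter (fun j => d j = lam i)) := by
      ext j; simp
    rw [this, Finset.card_biUnion]
    · exact Finset.sum_congr rfl fun i _ => hfr i
    · intro i _ i' _ hne
      rw [Function.onFun, Finset.disjoint_left]
      intro j hj hj'
      simp only [Finset.mem_filter, Finset.mem_univ, true_and] at hj hj'
      exact hne (hlam.injective (hj.symm.trans hj'))
  have hidx : ∀ j, ∃ i, d j = lam i := by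
    have h1 := hcard Finset.univ
    rw [hcomplete] at h1
    have h2 := Finset.eq_univ_of_card _ (h1.symm.trans (Fintype.card_fin m).symm)
    intro j
    have := h2 ▸ Finset.mem_univ j
    simpa using this
  choose idx hidx using hidx
  have hlt : ∀ j, lam k < d j ↔ idx j < k := fun j => by rw [hidx j, hlam.lt_iff_gt]
  have hgt : ∀ j, d j < lam k ↔ k < idx j := fun j => by rw [hidx j, hlam.lt_iff_gt]
  have hVS' : ∀ i, V i = S U (Finset.univ.filter (fun j => idx j = i)) := fun i => by
    rw [hVS]
    congr 1
    ext j
    simp [hidx j, hlam.injective.eq_iff]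
  have hcard' : ∀ I : Finset (Fin L), ∑ i ∈ I, finrank ℝ (V i)
      = (Finset.univ.filter (fun j => idx j ∈ I)).card := by
    intro I
    rw [hcard]
    congr 1
    ext j
    simp [hidx j, hlam.injective.eq_iff]
  have hsum_lt : ∑ i ∈ Finset.univ.filter (· < k), finrank ℝ (V i)
      = (Finset.univ.filter (fun j => idx j < k)).card := by
    rw [hcard']; simp
  have hsum_le : ∑ i ∈ Finset.univ.filter (· ≤ k), finrank ℝ (V i)
      = (Finset.univ.filter (fun j => idx j ≤ k)).card := by
    rw [hcard']; simp
  have hs : (Finset.univ.filter (fun j => idx j < k)).card ≤ q := by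
    rw [← hsum_lt]
    by_cases hk0 : k.1 = 0
    · have : Finset.univ.filter (· < k) = ∅ := by
        ext i; simp [Fin.lt_def, hk0]
      rw [this]; simp
    · have h := hkmin ⟨k.1 - 1, by omega⟩ (by rw [Fin.lt_def]; simp; omega)
      have : Finset.univ.filter (· < k) =
          Finset.univ.filter (· ≤ (⟨k.1 - 1, by omega⟩ : Fin L)) := by
        ext i
        simp only [Finset.mem_filter, Finset.mem_univ, true_and]
        rw [Fin.lt_def, Fin.le_def]
        dsimp only
        omega
      rw [this]; exact h.le
  have hA : (⨆ i : {i : Fin L // i < k}, V i.1) = S U (Finset.univ.filter (fun j => idx j < k)) := by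
    apply le_antisymm
    · refine iSup_le fun i => ?_
      rw [hVS']
      refine S_le hU' fun j hj => col_mem_S hU ?_
      simp only [Finset.mem_filter, Finset.mem_univ, true_and] at hj ⊢
      rw [hj]; exact i.2
    · refine S_le hU' fun j hj => ?_
      simp only [Finset.mem_filter, Finset.mem_univ, true_and] at hj
      refine Submodule.mem_iSup_of_mem ⟨idx j, hj⟩ ?_
      rw [hVS']
      exact col_mem_S hU (by simp)
  have hB : (⨆ i : {i : Fin L // i < k}, V i.1) ⊔ V k
      = S U (Finset.univ.filter (fun j => idx j ≤ k)) := by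
    rw [hA, hVS' k]
    apply le_antisymm
    · refine sup_le ?_ ?_
      · refine S_le hU' fun j hj => col_mem_S hU ?_
        simp only [Finset.mem_filter, Finset.mem_univ, true_and] at hj ⊢
        exact hj.le
      · refine S_le hU' fun j hj => col_mem_S hU ?_
        simp only [Finset.mem_filter, Finset.mem_univ, true_and] at hj ⊢
        exact hj.le
    · refine S_le hU' fun j hj => ?_
      simp only [Finset.mem_filter, Finset.mem_univ, true_and] at hj
      rcases hj.lt_or_eq with h | h
      · exact Submodule.mem_sup_left (col_mem_S hU (by simpa using h))
      · exact Submodule.mem_sup_right (col_mem_S hU (by simpa using h))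
  have hdisj : (⨆ i : {i : Fin L // i < k}, V i.1) ⊓ V k = ⊥ := by
    rw [hA, hVS' k, eq_bot_iff]
    rintro x ⟨hx1, hx2⟩
    rw [Submodule.mem_bot, expand hU' x]
    refine Finset.sum_eq_zero fun j _ => ?_
    by_cases hj : idx j < k
    · rw [hx2 j (by simpa using hj.ne), zero_smul]
    · rw [hx1 j (by simpa using hj), zero_smul]
  -- the two bounds
  have hb := fun (Q' : Matrix (Fin m) (Fin q) ℝ) (hQ' : Q'ᵀ * Q' = 1) =>
    bound d (w U Q') (lam k) (w_nonneg U Q') (w_le_one hU hU' hQ') (sum_w hU' hQ')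
  have hopt : (∀ Q' : Matrix (Fin m) (Fin q) ℝ, Q'ᵀ * Q' = 1 →
        Matrix.trace (Q'ᵀ * P * Q') ≤ Matrix.trace (Qᵀ * P * Q)) ↔
      ∀ j, (lam k < d j → w U Q j = 1) ∧ (d j < lam k → w U Q j = 0) := by
    rw [← (hb Q hQ).2, trace_eq hPd]
    constructor
    · intro h
      apply le_antisymm (hb Q hQ).1
      obtain ⟨T, hT1, hT2, hT3⟩ := Finset.exists_subsuperset_card_eq
        (s := Finset.univ.filter (fun j => idx j < k))
        (t := Finset.univ.filter (fun j => idx j ≤ k))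
        (by intro j; simp only [Finset.mem_filter, Finset.mem_univ, true_and]; exact le_of_lt)
        hs (hsum_le ▸ hk)
      obtain ⟨Q', hQ', hw⟩ := exists_Q hU T hT3
      have h1 := h Q' hQ'
      rw [trace_eq hPd, (hb Q' hQ').2.2] at h1
      · exact h1
      · intro j
        rw [hlt, hgt, hw]
        constructor
        · intro hj
          rw [if_pos (hT1 (by simpa using hj))]
        · intro hj
          rw [if_neg]
          intro hjT
          have := hT2 hjT
          simp only [Finset.mem_filter, Finset.mem_univ, true_and] at this
          exact absurd hj this.not_gt
    · intro h Q' hQ'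
      rw [trace_eq hPd, h]
      exact (hb Q' hQ').1
  have hsand : (∀ j, (lam k < d j → w U Q j = 1) ∧ (d j < lam k → w U Q j = 0)) ↔
      (⨆ i : {i : Fin L // i < k}, V i.1) ≤ LinearMap.range Q.mulVecLin ∧
      LinearMap.range Q.mulVecLin ≤ (⨆ i : {i : Fin L // i < k}, V i.1) ⊔ V k := by
    rw [hB, hA, forall_and]
    refine and_congr ?_ ?_
    · constructor
      · intro h
        refine S_le hU' fun j hj => (w_eq_one hU hU' hQ j).1 (h j ?_)
        simpa [hlt] using hj
      · intro h j hj
        refine (w_eq_one hU hU' hQ j).2 (h (col_mem_S hU ?_))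
        simpa [hlt] using hj
    · constructor
      · intro h x hx j hj
        refine (w_eq_zero j).1 (h j ?_) x hx
        simpa [hgt] using hj
      · intro h j hj
        refine (w_eq_zero j).2 fun x hx => h hx j ?_
        simpa [hgt] using hj
  rw [hopt, hsand, hsum_lt]
  have hfA : finrank ℝ ↥(⨆ i : {i : Fin L // i < k}, V i.1)
      = (Finset.univ.filter (fun j => idx j < k)).card := by
    rw [hA, finrank_S hU hU']
  have hfR := finrank_range hQ
  generalize (⨆ i : {i : Fin L // i < k}, V i.1) = A at *
  constructor
  · rintro ⟨h1, h2⟩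
    have hR : LinearMap.range Q.mulVecLin = A ⊔ (V k ⊓ LinearMap.range Q.mulVecLin) := by
      rw [← sup_inf_assoc_of_le _ h1, inf_eq_right.2 h2]
    refine ⟨V k ⊓ LinearMap.range Q.mulVecLin, inf_le_left, ?_, hR⟩
    have h3 := Submodule.finrank_sup_add_finrank_inf_eq A (V k ⊓ LinearMap.range Q.mulVecLin)
    rw [← hR, ← inf_assoc, hdisj, bot_inf_eq, finrank_bot, hfR, hfA] at h3
    omega
  · rintro ⟨W, hW, -, hR⟩
    rw [hR]
    exact ⟨le_sup_left, sup_le_sup_left hW _⟩
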